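/- On the open set {P ≠ 0} ⊂ ℝ⁴, the functions H₁ and H₂ are in involution with respect to the linear bracket: Σᵢⱼ πᵢⱼ (∂H₁/∂xᵢ)(∂H₂/∂xⱼ) = 0 at every point with P ≠ 0. -/

import Mathlib

open scoped Matrix

/-- Partial derivative `∂f/∂xᵢ` of a function on ℝ⁴. -/
noncomputable def pd (f : (Fin 4 → ℝ) → ℝ) (x : Fin 4 → ℝ) (i : Fin 4) : ℝ :=
  fderiv ℝ f x (Pi.single i 1)

/-- The linear Poisson bivector of the genus-2 Novikov system, in coordinates
`x = (U, U₁, P, P₁)`. -/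
noncomputable def Pmat (x : Fin 4 → ℝ) : Matrix (Fin 4) (Fin 4) ℝ :=
  !![0,        x 0 / 2, 0,        x 2;
     -x 0 / 2, 0,       -x 2,     -x 3 / 2;
     0,        x 2,     0,        0;
     -x 2,     x 3 / 2, 0,        0]

/-- The integral `H₁` as a function on `{x 2 ≠ 0} ⊂ ℝ⁴`, `x = (U, U₁, P, P₁)`. -/
noncomputable def H1f (t₁ t₂ t₃ : ℝ) (x : Fin 4 → ℝ) : ℝ :=
  -t₃ * x 2 - t₁ * x 0 - t₂ * x 0 / x 2 + x 2 * x 0 + (x 0) ^ 3 / (x 2) ^ 2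
    - x 0 * (x 3) ^ 2 / (4 * (x 2) ^ 2) + x 3 * x 1 / x 2

/-- The integral `H₂` as a function on `{x 2 ≠ 0} ⊂ ℝ⁴`. -/
noncomputable def H2f (t₁ t₂ t₃ : ℝ) (x : Fin 4 → ℝ) : ℝ :=
  -t₂ ^ 2 / (4 * x 2) - (1 / 4) * t₁ ^ 2 * x 2 - (1 / 6) * t₂ * x 2
    + (1 / 6) * t₁ * (x 2) ^ 2 - (x 2) ^ 3 / 36 - 2 * t₃ * x 0
    + (3 / 2) * (x 0) ^ 2 + t₂ * (x 0) ^ 2 / (2 * (x 2) ^ 2)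
    - t₁ * (x 0) ^ 2 / (2 * x 2) - (x 0) ^ 4 / (4 * (x 2) ^ 3)
    - (1 / 24) * (x 3) ^ 2 - t₂ * (x 3) ^ 2 / (8 * (x 2) ^ 2)
    + t₁ * (x 3) ^ 2 / (8 * x 2) + (x 0) ^ 2 * (x 3) ^ 2 / (8 * (x 2) ^ 3)
    - (x 3) ^ 4 / (64 * (x 2) ^ 3) + (x 1) ^ 2 / x 2

theorem pd_eq_of_hasDerivAt_line {f : (Fin 4 → ℝ) → ℝ} {x : Fin 4 → ℝ} {i : Fin 4} {f' : ℝ}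
    (hf : DifferentiableAt ℝ f x)
    (h : HasDerivAt (fun s : ℝ => f (x + s • (Pi.single i 1 : Fin 4 → ℝ))) f' 0) :
    pd f x i = f' := by
  rw [pd, ← hf.lineDeriv_eq_fderiv]
  exact h.deriv

theorem hasDerivAt_line_apply (x v : Fin 4 → ℝ) (i : Fin 4) :
    HasDerivAt (fun s : ℝ => (x + s • v) i) (v i) 0 := by
  simpa using ((hasDerivAt_id (0 : ℝ)).mul_const (v i)).const_add (x i)

theorem differentiableAt_H1f (t₁ t₂ t₃ : ℝ) {x : Fin 4 → ℝ} (hx : x 2 ≠ 0) :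
    DifferentiableAt ℝ (H1f t₁ t₂ t₃) x := by
  unfold H1f
  fun_prop (disch := simp [hx])

theorem differentiableAt_H2f (t₁ t₂ t₃ : ℝ) {x : Fin 4 → ℝ} (hx : x 2 ≠ 0) :
    DifferentiableAt ℝ (H2f t₁ t₂ t₃) x := by
  unfold H2f
  fun_prop (disch := simp [hx])

theorem hasDerivAt_H1f_line (t₁ t₂ t₃ : ℝ) {x : Fin 4 → ℝ} (hx : x 2 ≠ 0) (v : Fin 4 → ℝ) :
    HasDerivAt (fun s : ℝ => H1f t₁ t₂ t₃ (x + s • v))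
      ((-t₁ - t₂ / x 2 + x 2 + 3 * x 0 ^ 2 / x 2 ^ 2 - x 3 ^ 2 / (4 * x 2 ^ 2)) * v 0
        + x 3 / x 2 * v 1
        + (-t₃ + t₂ * x 0 / x 2 ^ 2 + x 0 - 2 * x 0 ^ 3 / x 2 ^ 3
          + x 0 * x 3 ^ 2 / (2 * x 2 ^ 3) - x 3 * x 1 / x 2 ^ 2) * v 2
        + (-x 0 * x 3 / (2 * x 2 ^ 2) + x 1 / x 2) * v 3) 0 := by
  have h0 := hasDerivAt_line_apply x v 0
  have h1 := hasDerivAt_line_apply x v 1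
  have h2 := hasDerivAt_line_apply x v 2
  have h3 := hasDerivAt_line_apply x v 3
  have n1 : (x + (0 : ℝ) • v) 2 ≠ 0 := by simpa using hx
  refine (((((((h2.const_mul (-t₃)).sub (h0.const_mul t₁)).sub
    ((h0.const_mul t₂).div h2 n1)).add (h2.mul h0)).add
    ((h0.pow 3).div (h2.pow 2) (pow_ne_zero 2 n1))).sub
    ((h0.mul (h3.pow 2)).div ((h2.pow 2).const_mul 4)
      (mul_ne_zero four_ne_zero (pow_ne_zero 2 n1)))).add
    ((h3.mul h1).div h2 n1)).congr_deriv ?_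
  simp
  field_simp
  ring

theorem hasDerivAt_H2f_line (t₁ t₂ t₃ : ℝ) {x : Fin 4 → ℝ} (hx : x 2 ≠ 0) (v : Fin 4 → ℝ) :
    HasDerivAt (fun s : ℝ => H2f t₁ t₂ t₃ (x + s • v))
      ((-2 * t₃ + 3 * x 0 + t₂ * x 0 / x 2 ^ 2 - t₁ * x 0 / x 2 - x 0 ^ 3 / x 2 ^ 3
          + x 0 * x 3 ^ 2 / (4 * x 2 ^ 3)) * v 0
        + 2 * x 1 / x 2 * v 1
        + (t₂ ^ 2 / (4 * x 2 ^ 2) - t₁ ^ 2 / 4 - t₂ / 6 + t₁ * x 2 / 3 - x 2 ^ 2 / 12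
          - t₂ * x 0 ^ 2 / x 2 ^ 3 + t₁ * x 0 ^ 2 / (2 * x 2 ^ 2) + 3 * x 0 ^ 4 / (4 * x 2 ^ 4)
          + t₂ * x 3 ^ 2 / (4 * x 2 ^ 3) - t₁ * x 3 ^ 2 / (8 * x 2 ^ 2)
          - 3 * x 0 ^ 2 * x 3 ^ 2 / (8 * x 2 ^ 4) + 3 * x 3 ^ 4 / (64 * x 2 ^ 4)
          - x 1 ^ 2 / x 2 ^ 2) * v 2
        + (-x 3 / 12 - t₂ * x 3 / (4 * x 2 ^ 2) + t₁ * x 3 / (4 * x 2)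
          + x 0 ^ 2 * x 3 / (4 * x 2 ^ 3) - x 3 ^ 3 / (16 * x 2 ^ 3)) * v 3) 0 := by
  have h0 := hasDerivAt_line_apply x v 0
  have h1 := hasDerivAt_line_apply x v 1
  have h2 := hasDerivAt_line_apply x v 2
  have h3 := hasDerivAt_line_apply x v 3
  have n1 : (x + (0 : ℝ) • v) 2 ≠ 0 := by simpa using hx
  have n (c : ℝ) (hc : c ≠ 0) (k : ℕ) : c * (x + (0 : ℝ) • v) 2 ^ k ≠ 0 :=
    mul_ne_zero hc (pow_ne_zero k n1)
  have n' (c : ℝ) (hc : c ≠ 0) : c * (x + (0 : ℝ) • v) 2 ≠ 0 := mul_ne_zero hc n1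
  refine (((((((((((((((
    ((hasDerivAt_const (0 : ℝ) (-t₂ ^ 2)).div (h2.const_mul 4) (n' 4 (by norm_num))).sub
    (h2.const_mul ((1 / 4) * t₁ ^ 2))).sub
    (h2.const_mul ((1 / 6) * t₂))).add
    ((h2.pow 2).const_mul ((1 / 6) * t₁))).sub
    ((h2.pow 3).div_const 36)).sub
    (h0.const_mul (2 * t₃))).add
    ((h0.pow 2).const_mul (3 / 2))).add
    (((h0.pow 2).const_mul t₂).div ((h2.pow 2).const_mul 2) (n 2 (by norm_num) 2))).sub
    (((h0.pow 2).const_mul t₁).div (h2.const_mul 2) (n' 2 (by norm_num)))).sub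
    ((h0.pow 4).div ((h2.pow 3).const_mul 4) (n 4 (by norm_num) 3))).sub
    ((h3.pow 2).const_mul (1 / 24))).sub
    (((h3.pow 2).const_mul t₂).div ((h2.pow 2).const_mul 8) (n 8 (by norm_num) 2))).add
    (((h3.pow 2).const_mul t₁).div (h2.const_mul 8) (n' 8 (by norm_num)))).add
    (((h0.pow 2).mul (h3.pow 2)).div ((h2.pow 3).const_mul 8) (n 8 (by norm_num) 3))).sub
    ((h3.pow 4).div ((h2.pow 3).const_mul 64) (n 64 (by norm_num) 3))).add
    ((h1.pow 2).div h2 n1)).congr_deriv ?_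
  simp
  field_simp
  ring

/-- `H₁` and `H₂` are in involution with respect to the linear bracket on the
open set `{P ≠ 0}`. -/
theorem stmt_10 (t₁ t₂ t₃ : ℝ) (x : Fin 4 → ℝ) (hx : x 2 ≠ 0) :
    ∑ i, ∑ j, Pmat x i j * pd (H1f t₁ t₂ t₃) x i * pd (H2f t₁ t₂ t₃) x j = 0 := by
  have e1 (i : Fin 4) := pd_eq_of_hasDerivAt_line (differentiableAt_H1f t₁ t₂ t₃ hx)
    (hasDerivAt_H1f_line t₁ t₂ t₃ hx (Pi.single i 1))
  have e2 (i : Fin 4) := pd_eq_of_hasDerivAt_line (differentiableAt_H2f t₁ t₂ t₃ hx)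
    (hasDerivAt_H2f_line t₁ t₂ t₃ hx (Pi.single i 1))
  simp only [e1, e2, Fin.sum_univ_four]
  simp [Pmat]
  field_simp
  ring
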